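/- If a permutation w ∈ S_n is not almost defined by inclusions, then w contains at least one of the patterns 53241, 52341, 52431, 35142, 42513, 351624. -/

import Mathlib

/-- One-line notation value of a permutation of `Fin n` at a position `k ∈ {1,…,n}`;
junk value `0` outside that range. -/
def pval {n : ℕ} (w : Equiv.Perm (Fin n)) (k : ℕ) : ℕ :=
  if h : 1 ≤ k ∧ k ≤ n then ((w ⟨k - 1, by omega⟩ : Fin n) : ℕ) + 1 else 0

/-- The rank function `r_w(p,q) = #{k ≤ q : w(k) ≥ p}`. -/
def rk {n : ℕ} (w : Equiv.Perm (Fin n)) (p q : ℕ) : ℕ :=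
  ((Finset.Icc 1 n).filter fun k => k ≤ q ∧ p ≤ pval w k).card

/-- The Rothe diagram `D(w) = {(p,q) ∈ {1,…,n}² : w(q) < p and w⁻¹(p) > q}`. -/
def Diagram {n : ℕ} (w : Equiv.Perm (Fin n)) : Set (ℕ × ℕ) :=
  {pq | 1 ≤ pq.1 ∧ pq.1 ≤ n ∧ 1 ≤ pq.2 ∧ pq.2 ≤ n ∧
    pval w pq.2 < pq.1 ∧ pq.2 < pval w.symm pq.1}

/-- The essential set `E(w)`. -/
def EssSet {n : ℕ} (w : Equiv.Perm (Fin n)) : Set (ℕ × ℕ) :=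
  {pq | pq ∈ Diagram w ∧ (pq.1, pq.2 + 1) ∉ Diagram w ∧ (pq.1 - 1, pq.2) ∉ Diagram w}

/-- Condition A at `(p,q)`: there is no `k` with `k ≤ q` and `w(k) ≥ p`. -/
def CondA {n : ℕ} (w : Equiv.Perm (Fin n)) (p q : ℕ) : Prop :=
  ¬ ∃ k, 1 ≤ k ∧ k ≤ n ∧ k ≤ q ∧ p ≤ pval w k

/-- Condition B at `(p,q)`: there is no `k` with `k > q` and `w(k) < p`. -/
def CondB {n : ℕ} (w : Equiv.Perm (Fin n)) (p q : ℕ) : Prop :=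
  ¬ ∃ k, 1 ≤ k ∧ k ≤ n ∧ q < k ∧ pval w k < p

/-- `w` is defined by inclusions if every essential set box satisfies Condition A or B. -/
def DefinedByInclusions {n : ℕ} (w : Equiv.Perm (Fin n)) : Prop :=
  ∀ p q, (p, q) ∈ EssSet w → CondA w p q ∨ CondB w p q

/-- Condition W at `(p,q) ∈ E(w)`. -/
def CondW {n : ℕ} (w : Equiv.Perm (Fin n)) (p q : ℕ) : Prop :=
  (∀ p' < p, (p', q) ∉ EssSet w) ∧
    ((p, q - 1) ∉ Diagram w ∨
      ∃ p' < p, (p', q - 1) ∈ EssSet w ∧ CondB w p' (q - 1) ∧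
        rk w p' (q - 1) = rk w p q)

/-- Condition X at `(p,q) ∈ E(w)`. -/
def CondX {n : ℕ} (w : Equiv.Perm (Fin n)) (p q : ℕ) : Prop :=
  ∃ p' < p, (p', q) ∈ EssSet w ∧ (∀ p'' < p, (p'', q) ∈ EssSet w → p'' = p') ∧
    CondB w p' q ∧ rk w p' q = rk w p q + 1 ∧
    ∃ q', IsLeast {c | ∀ b, c ≤ b → b ≤ q → (p', b) ∈ Diagram w} q' ∧
      (p, q' - 1) ∈ Diagram w

/-- Condition Y at `(p,q) ∈ E(w)`. -/
def CondY {n : ℕ} (w : Equiv.Perm (Fin n)) (p q : ℕ) : Prop :=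
  (∀ q' > q, (p, q') ∉ EssSet w) ∧
    ((p + 1, q) ∉ Diagram w ∨
      ∃ q' > q, (p + 1, q') ∈ EssSet w ∧ CondB w (p + 1) q' ∧
        rk w (p + 1) q' = rk w p q)

/-- Condition Z at `(p,q) ∈ E(w)`. -/
def CondZ {n : ℕ} (w : Equiv.Perm (Fin n)) (p q : ℕ) : Prop :=
  ∃ q' > q, (p, q') ∈ EssSet w ∧ (∀ q'' > q, (p, q'') ∈ EssSet w → q'' = q') ∧
    CondB w p q' ∧ rk w p q' = rk w p q + 1 ∧
    ∃ p', IsGreatest {c | ∀ a, p ≤ a → a ≤ c → (a, q') ∈ Diagram w} p' ∧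
      (p' + 1, q) ∈ Diagram w

/-- `w` is almost defined by inclusions if every essential box satisfies Condition A or B,
or satisfies both one of Conditions W and X and one of Conditions Y and Z. -/
def AlmostDBI {n : ℕ} (w : Equiv.Perm (Fin n)) : Prop :=
  ∀ p q, (p, q) ∈ EssSet w →
    (CondA w p q ∨ CondB w p q) ∨
      ((CondW w p q ∨ CondX w p q) ∧ (CondY w p q ∨ CondZ w p q))
/-- `w` contains the (classical) pattern given in one-line notation by the list `v`. -/
def Contains {n : ℕ} (w : Equiv.Perm (Fin n)) (v : List ℕ) : Prop :=
  ∃ f : Fin v.length → Fin n, StrictMono f ∧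
    ∀ j k : Fin v.length, w (f j) < w (f k) ↔ v.get j < v.get k

theorem pval_pos {n : ℕ} (w : Equiv.Perm (Fin n)) {k : ℕ} (h1 : 1 ≤ k) (h2 : k ≤ n) :
    1 ≤ pval w k := by
  simp [pval, h1, h2]

theorem pval_le {n : ℕ} (w : Equiv.Perm (Fin n)) (k : ℕ) : pval w k ≤ n := by
  unfold pval
  split_ifs <;> omega

theorem pval_symm_pval {n : ℕ} (w : Equiv.Perm (Fin n)) {k : ℕ} (h1 : 1 ≤ k) (h2 : k ≤ n) :
    pval w.symm (pval w k) = k := by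
  have : 1 ≤ pval w k ∧ pval w k ≤ n := ⟨pval_pos w h1 h2, pval_le w k⟩
  rw [pval, dif_pos this]
  simp [pval, h1, h2]

theorem pval_pval_symm {n : ℕ} (w : Equiv.Perm (Fin n)) {k : ℕ} (h1 : 1 ≤ k) (h2 : k ≤ n) :
    pval w (pval w.symm k) = k :=
  pval_symm_pval w.symm h1 h2

theorem pval_fin {n : ℕ} (w : Equiv.Perm (Fin n)) (i : Fin n) :
    pval w (i + 1) = w i + 1 := by
  have : (i : ℕ) + 1 ≤ n := i.2
  simp [pval, this]

/-- Pattern containment in terms of one-line notation values at positions `1, …, n`. -/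
theorem contains_iff_pval {n : ℕ} (w : Equiv.Perm (Fin n)) {v : List ℕ} (hv : v.Nodup) :
    Contains w v ↔ ∃ i : Fin v.length → ℕ, StrictMono i ∧ (∀ j, 1 ≤ i j ∧ i j ≤ n) ∧
      ∀ j k, v.get j < v.get k → pval w (i j) < pval w (i k) := by
  constructor
  · rintro ⟨f, hf, hw⟩
    refine ⟨fun j => f j + 1, fun j k h => ?_, fun j => ⟨Nat.le_add_left _ _, (f j).2⟩,
      fun j k h => ?_⟩
    · simpa using hf h
    · simpa only [pval_fin, add_lt_add_iff_right] using Fin.lt_def.1 ((hw j k).2 h)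
  · rintro ⟨i, hi, hr, hp⟩
    have hlt : ∀ j, i j - 1 < n := fun j => by have := hr j; omega
    have hw : ∀ j, (w ⟨i j - 1, hlt j⟩ : ℕ) + 1 = pval w (i j) := fun j => by
      rw [← pval_fin, Nat.sub_add_cancel (hr j).1]
    refine ⟨fun j => ⟨i j - 1, hlt j⟩, fun j k h => ?_, fun j k => ⟨fun h => ?_, fun h => ?_⟩⟩
    · have := hi h
      have := hr j
      simp only [Fin.mk_lt_mk]
      omega
    · by_contra hle
      rcases (not_lt.1 hle).lt_or_eq with h' | h'
      · have := hp k j h'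
        replace h : (w ⟨i j - 1, hlt j⟩ : ℕ) < w ⟨i k - 1, hlt k⟩ := h
        have := hw j
        have := hw k
        omega
      · rw [hv.injective_get h'] at h
        exact lt_irrefl _ h
    · have := hp j k h
      change (w ⟨i j - 1, hlt j⟩ : ℕ) < w ⟨i k - 1, hlt k⟩
      have := hw j
      have := hw k
      omega

theorem contains_53241_iff {n : ℕ} (w : Equiv.Perm (Fin n)) :
    Contains w [5, 3, 2, 4, 1] ↔ ∃ i₁ i₂ i₃ i₄ i₅,
      1 ≤ i₁ ∧ i₁ < i₂ ∧ i₂ < i₃ ∧ i₃ < i₄ ∧ i₄ < i₅ ∧ i₅ ≤ n ∧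
        pval w i₅ < pval w i₃ ∧ pval w i₃ < pval w i₂ ∧ pval w i₂ < pval w i₄ ∧
        pval w i₄ < pval w i₁ := by
  rw [contains_iff_pval w (by decide)]
  constructor
  · rintro ⟨i, hi, hr, hp⟩
    exact ⟨_, _, _, _, _, (hr 0).1,
      hi (a := 0) (b := 1) (by decide), hi (a := 1) (b := 2) (by decide),
      hi (a := 2) (b := 3) (by decide), hi (a := 3) (b := 4) (by decide),
      (hr 4).2, hp 4 2 (by decide), hp 2 1 (by decide), hp 1 3 (by decide), hp 3 0 (by decide)⟩
  · rintro ⟨i₁, i₂, i₃, i₄, i₅, h⟩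
    refine ⟨![i₁, i₂, i₃, i₄, i₅], Fin.strictMono_iff_lt_succ.2 ?_, ?_, ?_⟩ <;>
      simp [Fin.forall_fin_succ] <;> omega

theorem contains_52341_iff {n : ℕ} (w : Equiv.Perm (Fin n)) :
    Contains w [5, 2, 3, 4, 1] ↔ ∃ i₁ i₂ i₃ i₄ i₅,
      1 ≤ i₁ ∧ i₁ < i₂ ∧ i₂ < i₃ ∧ i₃ < i₄ ∧ i₄ < i₅ ∧ i₅ ≤ n ∧
        pval w i₅ < pval w i₂ ∧ pval w i₂ < pval w i₃ ∧ pval w i₃ < pval w i₄ ∧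
        pval w i₄ < pval w i₁ := by
  rw [contains_iff_pval w (by decide)]
  constructor
  · rintro ⟨i, hi, hr, hp⟩
    exact ⟨_, _, _, _, _, (hr 0).1,
      hi (a := 0) (b := 1) (by decide), hi (a := 1) (b := 2) (by decide),
      hi (a := 2) (b := 3) (by decide), hi (a := 3) (b := 4) (by decide),
      (hr 4).2, hp 4 1 (by decide), hp 1 2 (by decide), hp 2 3 (by decide), hp 3 0 (by decide)⟩
  · rintro ⟨i₁, i₂, i₃, i₄, i₅, h⟩
    refine ⟨![i₁, i₂, i₃, i₄, i₅], Fin.strictMono_iff_lt_succ.2 ?_, ?_, ?_⟩ <;>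
      simp [Fin.forall_fin_succ] <;> omega

theorem contains_52431_iff {n : ℕ} (w : Equiv.Perm (Fin n)) :
    Contains w [5, 2, 4, 3, 1] ↔ ∃ i₁ i₂ i₃ i₄ i₅,
      1 ≤ i₁ ∧ i₁ < i₂ ∧ i₂ < i₃ ∧ i₃ < i₄ ∧ i₄ < i₅ ∧ i₅ ≤ n ∧
        pval w i₅ < pval w i₂ ∧ pval w i₂ < pval w i₄ ∧ pval w i₄ < pval w i₃ ∧
        pval w i₃ < pval w i₁ := by
  rw [contains_iff_pval w (by decide)]
  constructor
  · rintro ⟨i, hi, hr, hp⟩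
    exact ⟨_, _, _, _, _, (hr 0).1,
      hi (a := 0) (b := 1) (by decide), hi (a := 1) (b := 2) (by decide),
      hi (a := 2) (b := 3) (by decide), hi (a := 3) (b := 4) (by decide),
      (hr 4).2, hp 4 1 (by decide), hp 1 3 (by decide), hp 3 2 (by decide), hp 2 0 (by decide)⟩
  · rintro ⟨i₁, i₂, i₃, i₄, i₅, h⟩
    refine ⟨![i₁, i₂, i₃, i₄, i₅], Fin.strictMono_iff_lt_succ.2 ?_, ?_, ?_⟩ <;>
      simp [Fin.forall_fin_succ] <;> omega

theorem contains_35142_iff {n : ℕ} (w : Equiv.Perm (Fin n)) :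
    Contains w [3, 5, 1, 4, 2] ↔ ∃ i₁ i₂ i₃ i₄ i₅,
      1 ≤ i₁ ∧ i₁ < i₂ ∧ i₂ < i₃ ∧ i₃ < i₄ ∧ i₄ < i₅ ∧ i₅ ≤ n ∧
        pval w i₃ < pval w i₅ ∧ pval w i₅ < pval w i₁ ∧ pval w i₁ < pval w i₄ ∧
        pval w i₄ < pval w i₂ := by
  rw [contains_iff_pval w (by decide)]
  constructor
  · rintro ⟨i, hi, hr, hp⟩
    exact ⟨_, _, _, _, _, (hr 0).1,
      hi (a := 0) (b := 1) (by decide), hi (a := 1) (b := 2) (by decide),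
      hi (a := 2) (b := 3) (by decide), hi (a := 3) (b := 4) (by decide),
      (hr 4).2, hp 2 4 (by decide), hp 4 0 (by decide), hp 0 3 (by decide), hp 3 1 (by decide)⟩
  · rintro ⟨i₁, i₂, i₃, i₄, i₅, h⟩
    refine ⟨![i₁, i₂, i₃, i₄, i₅], Fin.strictMono_iff_lt_succ.2 ?_, ?_, ?_⟩ <;>
      simp [Fin.forall_fin_succ] <;> omega

theorem contains_42513_iff {n : ℕ} (w : Equiv.Perm (Fin n)) :
    Contains w [4, 2, 5, 1, 3] ↔ ∃ i₁ i₂ i₃ i₄ i₅,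
      1 ≤ i₁ ∧ i₁ < i₂ ∧ i₂ < i₃ ∧ i₃ < i₄ ∧ i₄ < i₅ ∧ i₅ ≤ n ∧
        pval w i₄ < pval w i₂ ∧ pval w i₂ < pval w i₅ ∧ pval w i₅ < pval w i₁ ∧
        pval w i₁ < pval w i₃ := by
  rw [contains_iff_pval w (by decide)]
  constructor
  · rintro ⟨i, hi, hr, hp⟩
    exact ⟨_, _, _, _, _, (hr 0).1,
      hi (a := 0) (b := 1) (by decide), hi (a := 1) (b := 2) (by decide),
      hi (a := 2) (b := 3) (by decide), hi (a := 3) (b := 4) (by decide),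
      (hr 4).2, hp 3 1 (by decide), hp 1 4 (by decide), hp 4 0 (by decide), hp 0 2 (by decide)⟩
  · rintro ⟨i₁, i₂, i₃, i₄, i₅, h⟩
    refine ⟨![i₁, i₂, i₃, i₄, i₅], Fin.strictMono_iff_lt_succ.2 ?_, ?_, ?_⟩ <;>
      simp [Fin.forall_fin_succ] <;> omega

theorem contains_351624_iff {n : ℕ} (w : Equiv.Perm (Fin n)) :
    Contains w [3, 5, 1, 6, 2, 4] ↔ ∃ i₁ i₂ i₃ i₄ i₅ i₆,
      1 ≤ i₁ ∧ i₁ < i₂ ∧ i₂ < i₃ ∧ i₃ < i₄ ∧ i₄ < i₅ ∧ i₅ < i₆ ∧ i₆ ≤ n ∧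
        pval w i₃ < pval w i₅ ∧ pval w i₅ < pval w i₁ ∧ pval w i₁ < pval w i₆ ∧
        pval w i₆ < pval w i₂ ∧ pval w i₂ < pval w i₄ := by
  rw [contains_iff_pval w (by decide)]
  constructor
  · rintro ⟨i, hi, hr, hp⟩
    exact ⟨_, _, _, _, _, _, (hr 0).1,
      hi (a := 0) (b := 1) (by decide), hi (a := 1) (b := 2) (by decide),
      hi (a := 2) (b := 3) (by decide), hi (a := 3) (b := 4) (by decide),
      hi (a := 4) (b := 5) (by decide),
      (hr 5).2, hp 2 4 (by decide), hp 4 0 (by decide), hp 0 5 (by decide),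
      hp 5 1 (by decide), hp 1 3 (by decide)⟩
  · rintro ⟨i₁, i₂, i₃, i₄, i₅, i₆, h⟩
    refine ⟨![i₁, i₂, i₃, i₄, i₅, i₆], Fin.strictMono_iff_lt_succ.2 ?_, ?_, ?_⟩ <;>
      simp [Fin.forall_fin_succ] <;> omega

/-- `w` contains one of the patterns 53241, 52341, 52431, 35142, 42513, 351624. -/
def ContainsForbidden {n : ℕ} (w : Equiv.Perm (Fin n)) : Prop :=
  Contains w [5, 3, 2, 4, 1] ∨ Contains w [5, 2, 3, 4, 1] ∨
    Contains w [5, 2, 4, 3, 1] ∨ Contains w [3, 5, 1, 4, 2] ∨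
    Contains w [4, 2, 5, 1, 3] ∨ Contains w [3, 5, 1, 6, 2, 4]

theorem mem_diagram_iff {n : ℕ} (w : Equiv.Perm (Fin n)) (p q : ℕ) :
    (p, q) ∈ Diagram w ↔ 1 ≤ p ∧ p ≤ n ∧ 1 ≤ q ∧ q ≤ n ∧
      pval w q < p ∧ q < pval w.symm p :=
  Iff.rfl

theorem mem_essSet_iff {n : ℕ} (w : Equiv.Perm (Fin n)) (p q : ℕ) :
    (p, q) ∈ EssSet w ↔ 2 ≤ p ∧ p ≤ n ∧ 1 ≤ q ∧ q < n ∧ pval w q < p ∧ p ≤ pval w (q + 1) ∧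
      pval w.symm (p - 1) ≤ q ∧ q < pval w.symm p := by
  simp only [EssSet, Set.mem_ofPred_eq, mem_diagram_iff]
  constructor
  · rintro ⟨⟨hp1, hpn, hq1, hqn, hwq, hqw⟩, hr, hu⟩
    have h1 := pval_le w.symm p
    have h2 := pval_pos w hq1 hqn
    refine ⟨by omega, hpn, hq1, by omega, hwq, ?_, ?_, hqw⟩
    · by_contra hlt
      have hne : pval w.symm p ≠ q + 1 := fun h => by
        have := pval_pval_symm w hp1 hpn
        rw [h] at this
        omega
      exact hr ⟨hp1, hpn, by omega, by omega, by omega, by omega⟩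
    · by_contra hlt
      have hne : pval w q ≠ p - 1 := fun h => by
        have := pval_symm_pval w hq1 hqn
        rw [h] at this
        omega
      exact hu ⟨by omega, by omega, hq1, hqn, by omega, by omega⟩
  · rintro ⟨hp2, hpn, hq1, hqn, hwq, hwq', hu, hqw⟩
    exact ⟨⟨by omega, hpn, hq1, by omega, hwq, hqw⟩, by omega, by omega⟩

section Forcing

variable {n : ℕ} {w : Equiv.Perm (Fin n)} {p q : ℕ}

theorem pval_ne_of_lt_pval_symm {k : ℕ} (hk1 : 1 ≤ k)
    (hkq : k ≤ q) (hq : q < pval w.symm p) : pval w k ≠ p := fun h => by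
  have h1 := pval_symm_pval w hk1 (by have := pval_le w.symm p; omega)
  rw [h] at h1
  omega

/-- An entry `≥ p` between or left of two entries `< p`, the second smaller than an entry right of
column `q` and the first larger than it. -/
theorem containsForbidden_of_lt_of_lt (hE : (p, q) ∈ EssSet w) {c k d b : ℕ} (hc1 : 1 ≤ c)
    (hck : c < k) (hkd : k < d) (hdq : d ≤ q) (hqb : q < b) (hbn : b ≤ n)
    (hdb : pval w d < pval w b) (hbc : pval w b < pval w c) (hcp : pval w c < p)
    (hk : p ≤ pval w k) : ContainsForbidden w := by
  obtain ⟨hp2, hpn, hq1, hqn, hwq, hwq', hu, hqw⟩ := (mem_essSet_iff w p q).1 hE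
  have he := pval_pval_symm w (k := p) (by omega) hpn
  have hen := pval_le w.symm p
  have hkp : pval w k ≠ p := pval_ne_of_lt_pval_symm (q := q) (by omega) (by omega) hqw
  have hbq : b ≠ q + 1 := by rintro rfl; omega
  generalize pval w.symm p = e at *
  have hbe : b ≠ e := by rintro rfl; omega
  have hkq : pval w k ≠ pval w (q + 1) := fun h => by
    have h1 := pval_symm_pval w (k := k) (by omega) (by omega)
    have h2 := pval_symm_pval w (k := q + 1) (by omega) (by omega)
    rw [h] at h1
    omega
  by_cases heb : e < b
  · exact .inr <| .inr <| .inr <| .inl <| (contains_35142_iff w).2 ⟨c, k, d, e, b, by omega⟩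
  by_cases hlt : pval w (q + 1) < pval w k
  · exact .inr <| .inr <| .inr <| .inl <| (contains_35142_iff w).2 ⟨c, k, d, q + 1, b, by omega⟩
  have hqe : q + 1 ≠ e := by rintro rfl; omega
  exact .inr <| .inr <| .inr <| .inr <| .inr <|
    (contains_351624_iff w).2 ⟨c, k, d, q + 1, b, e, by omega⟩

theorem containsForbidden_or_exists_between (hE : (p, q) ∈ EssSet w) {k c b : ℕ} (hk1 : 1 ≤ k)
    (hkc : k < c) (hcq : c ≤ q) (hqb : q < b) (hbn : b ≤ n) (hbc : pval w b < pval w c)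
    (hcp : pval w c < p) (hk : p ≤ pval w k) :
    ContainsForbidden w ∨ ∃ x, q < x ∧ x < b ∧ p ≤ pval w x ∧ pval w x < pval w k := by
  obtain ⟨hp2, hpn, hq1, hqn, hwq, hwq', hu, hqw⟩ := (mem_essSet_iff w p q).1 hE
  have he := pval_pval_symm w (k := p) (by omega) hpn
  have hen := pval_le w.symm p
  have hkp : pval w k ≠ p := pval_ne_of_lt_pval_symm (q := q) hk1 (by omega) hqw
  have hbq : b ≠ q + 1 := by rintro rfl; omega
  generalize pval w.symm p = e at *
  have hbe : b ≠ e := by rintro rfl; omega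
  have hkq : pval w k ≠ pval w (q + 1) := fun h => by
    have h1 := pval_symm_pval w (k := k) (by omega) (by omega)
    have h2 := pval_symm_pval w (k := q + 1) (by omega) (by omega)
    rw [h] at h1
    omega
  by_cases heb : e < b
  · exact .inr ⟨e, by omega⟩
  by_cases hlt : pval w (q + 1) < pval w k
  · exact .inr ⟨q + 1, by omega⟩
  have hqe : q + 1 ≠ e := by rintro rfl; omega
  exact .inl <| .inr <| .inr <| .inr <| .inr <| .inl <|
    (contains_42513_iff w).2 ⟨k, c, q + 1, b, e, by omega⟩

/-- An entry `≥ p` followed weakly left of column `q` by two entries `< p`, both larger than an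
entry right of column `q`. -/
theorem containsForbidden_of_ne (hE : (p, q) ∈ EssSet w) {k c d b : ℕ} (hk1 : 1 ≤ k)
    (hkc : k < c) (hkd : k < d) (hcd : c ≠ d) (hcq : c ≤ q) (hdq : d ≤ q) (hqb : q < b)
    (hbn : b ≤ n) (hbc : pval w b < pval w c) (hbd : pval w b < pval w d) (hcp : pval w c < p)
    (hdp : pval w d < p) (hk : p ≤ pval w k) : ContainsForbidden w := by
  wlog hlt : c < d generalizing c d
  · exact this hkd hkc hcd.symm hdq hcq hbd hbc hdp hcp (by omega)
  obtain h | ⟨x, hx⟩ := containsForbidden_or_exists_between hE hk1 hkc hcq hqb hbn hbc hcp hk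
  · exact h
  have hne : pval w c ≠ pval w d := fun h => by
    have h1 := pval_symm_pval w (k := c) (by omega) (by omega)
    have h2 := pval_symm_pval w (k := d) (by omega) (by omega)
    rw [h] at h1
    omega
  rcases lt_or_gt_of_ne hne with h | h
  · exact .inr <| .inl <| (contains_52341_iff w).2 ⟨k, c, d, x, b, by omega⟩
  · exact .inl <| (contains_53241_iff w).2 ⟨k, c, d, x, b, by omega⟩

theorem rk_eq_add_one {p' a : ℕ} (hpp : p' ≤ p) (ha1 : 1 ≤ a) (haq : a ≤ q) (han : a ≤ n)
    (hpa : p' ≤ pval w a) (hap : pval w a < p)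
    (huniq : ∀ c, 1 ≤ c → c ≤ q → p' ≤ pval w c → pval w c < p → c = a) :
    rk w p' q = rk w p q + 1 := by
  unfold rk
  rw [← Finset.card_insert_of_notMem (a := a) (by simp; omega)]
  congr 1
  ext c
  simp only [Finset.mem_filter, Finset.mem_Icc, Finset.mem_insert]
  constructor
  · rintro ⟨⟨h1, h2⟩, h3, h4⟩
    by_cases h : p ≤ pval w c
    · exact .inr ⟨⟨h1, h2⟩, h3, h⟩
    · exact .inl (huniq c h1 h3 h4 (by omega))
  · rintro (rfl | h) <;> omega

theorem containsForbidden_or_condX (hE : (p, q) ∈ EssSet w) (hA : ¬ CondA w p q) {p' : ℕ}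
    (hpp : p' < p) (hE' : (p', q) ∈ EssSet w) : ContainsForbidden w ∨ CondX w p q := by
  by_contra! hcon
  obtain ⟨hcon, hX⟩ := hcon
  simp only [CondA, not_not] at hA
  obtain ⟨k, hk1, hkn, hkq, hk⟩ := hA
  obtain ⟨hp2, hpn, hq1, hqn, hwq, hwq', hu, hqw⟩ := (mem_essSet_iff w p q).1 hE
  -- entries `≥ p` precede entries in `[r, p)` for every essential box `(r, q)` above `(p, q)`
  have before : ∀ r < p, (r, q) ∈ EssSet w → ∀ k, 1 ≤ k → k ≤ q → p ≤ pval w k →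
      ∀ c, 1 ≤ c → c ≤ q → r ≤ pval w c → pval w c < p →
      k < c ∧ pval w (pval w.symm r) < pval w c := by
    intro r hr hEr k hk1 hkq hk c hc1 hcq hrc hcp
    obtain ⟨hr2, hrn, -, -, hrq, -, -, hqr⟩ := (mem_essSet_iff w r q).1 hEr
    have hb := pval_pval_symm w (k := r) (by omega) hrn
    have hcr := pval_ne_of_lt_pval_symm (w := w) hc1 hcq hqr
    have hck : c ≠ k := by rintro rfl; omega
    have hkq' : k ≠ q := by rintro rfl; omega
    refine ⟨?_, by omega⟩
    by_contra hlt
    exact hcon (containsForbidden_of_lt_of_lt hE hc1 (k := k) (by omega) (by omega) le_rfl hqr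
      (pval_le _ _) (by omega) (by omega) hcp hk)
  have uniq : ∀ r < p, (r, q) ∈ EssSet w → ∀ c d, 1 ≤ c → c ≤ q → r ≤ pval w c → pval w c < p →
      1 ≤ d → d ≤ q → r ≤ pval w d → pval w d < p → c = d := by
    intro r hr hEr c d hc1 hcq hrc hcp hd1 hdq hrd hdp
    by_contra hne
    have h1 := before r hr hEr k hk1 hkq hk c hc1 hcq hrc hcp
    have h2 := before r hr hEr k hk1 hkq hk d hd1 hdq hrd hdp
    obtain ⟨hr2, hrn, -, -, hrq, -, -, hqr⟩ := (mem_essSet_iff w r q).1 hEr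
    exact hcon (containsForbidden_of_ne hE hk1 h1.1 h2.1 hne hcq hdq hqr
      (pval_le _ _) h1.2 h2.2 hcp hdp hk)
  obtain ⟨hr2, hrn, -, -, hrq, hrq', hru, hqr⟩ := (mem_essSet_iff w p' q).1 hE'
  have ha := pval_pval_symm w (k := p - 1) (by omega) (by omega)
  have ha1 := pval_pos w.symm (k := p - 1) (by omega) (by omega)
  generalize pval w.symm (p - 1) = a at *
  have key := fun r hr hEr hra => fun c => uniq r hr hEr a c ha1 hu hra (by omega)
  have key' := fun k hk1 hkq hk => (before p' hpp hE' k hk1 hkq hk a ha1 hu (by omega) (by omega)).1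
  have hka := key' k hk1 hkq hk
  refine hX ⟨p', hpp, hE', ?_, ?_, ?_, ?_⟩
  · have aux : ∀ r s, r < s → s < p → (r, q) ∈ EssSet w → (s, q) ∈ EssSet w → False := by
      intro r s hrs hsp hEr hEs
      obtain ⟨hs2, hsn, -, -, -, -, hsu, -⟩ := (mem_essSet_iff w s q).1 hEs
      have hc := pval_pval_symm w (k := s - 1) (by omega) (by omega)
      have hc1 := pval_pos w.symm (k := s - 1) (by omega) (by omega)
      have := key r (by omega) hEr (by omega) _ hc1 hsu (by omega) (by omega)
      rw [← this] at hc
      omega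
    intro r hr hEr
    rcases lt_trichotomy r p' with h | h | h
    · exact (aux r p' h hpp hEr hE').elim
    · exact h
    · exact (aux p' r h hr hE' hEr).elim
  · rintro ⟨l, hl1, hln, hql, hl⟩
    have hc := pval_pval_symm w (k := p' - 1) (by omega) (by omega)
    have hc1 := pval_pos w.symm (k := p' - 1) (by omega) (by omega)
    generalize pval w.symm (p' - 1) = c at *
    have hlc : pval w l ≠ p' - 1 := fun h => by
      have h1 := pval_symm_pval w hl1 hln
      have h2 := pval_symm_pval w hc1 (by omega)
      rw [h, ← hc] at h1
      omega
    have hca : a ≠ c := by rintro rfl; omega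
    have hck : c ≠ k := by rintro rfl; omega
    have haq : a ≠ q := by rintro rfl; omega
    have hlq : pval w l ≠ pval w q := fun h => by
      have h1 := pval_symm_pval w hl1 hln
      have h2 := pval_symm_pval w hq1 (by omega)
      rw [h] at h1
      omega
    by_cases hkc : k < c
    · exact hcon (containsForbidden_of_ne hE hk1 hka hkc hca hu hru hql hln (by omega) (by omega)
        (by omega) (by omega) hk)
    by_cases hlt : pval w l < pval w q
    · exact hcon (containsForbidden_of_ne hE hk1 hka (d := q) (by omega) haq hu le_rfl hql hln
        (by omega) (by omega) (by omega) (by omega) hk)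
    · exact hcon (containsForbidden_of_lt_of_lt hE hc1 (k := k) (d := q) (by omega) (by omega)
        le_rfl hql hln (by omega) (by omega) (by omega) hk)
  · exact rk_eq_add_one hpp.le ha1 hu (by omega) (by omega) (by omega)
      fun c h1 h2 h3 h4 => (key p' hpp hE' (by omega) c h1 h2 h3 h4).symm
  · set S := {c | ∀ b, c ≤ b → b ≤ q → (p', b) ∈ Diagram w} with hS
    have hqS : q ∈ S := fun b h1 h2 => (le_antisymm h1 h2) ▸ hE'.1
    have hmem : sInf S ∈ S := Nat.sInf_mem ⟨q, hqS⟩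
    have hle : ∀ c ∈ S, sInf S ≤ c := fun c hc => Nat.sInf_le hc
    refine ⟨sInf S, ⟨hmem, hle⟩, ?_⟩
    have hsq := hle q hqS
    generalize sInf S = s at *
    have has : a < s := by
      by_contra hlt
      have := (mem_diagram_iff w _ _).1 (hmem a (by omega) hu)
      omega
    have hpred : p' ≤ pval w (s - 1) := by
      by_contra hlt
      have : s - 1 ∈ S := by
        intro b h1 h2
        rcases eq_or_ne b (s - 1) with rfl | h
        · exact (mem_diagram_iff w _ _).2 (by omega)
        · exact hmem b (by omega) h2
      have := hle _ this
      omega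
    have : pval w (s - 1) < p := by
      by_contra hge
      have := key' (s - 1) (by omega) (by omega) (by omega)
      omega
    exact (mem_diagram_iff w _ _).2 (by omega)

theorem containsForbidden_or_condW (hE : (p, q) ∈ EssSet w) (hA : ¬ CondA w p q)
    (hB : ¬ CondB w p q) (hno : ∀ p' < p, (p', q) ∉ EssSet w) :
    ContainsForbidden w ∨ CondW w p q := by
  by_contra! hcon
  obtain ⟨hcon, hW⟩ := hcon
  simp only [CondA, not_not] at hA
  simp only [CondB, not_not] at hB
  obtain ⟨k, hk1, hkn, hkq, hk⟩ := hA
  obtain ⟨l, hl1, hln, hql, hl⟩ := hB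
  obtain ⟨hp2, hpn, hq1, hqn, hwq, hwq', hu, hqw⟩ := (mem_essSet_iff w p q).1 hE
  have hq0 := pval_pos w hq1 (by omega)
  have hleft : ∀ v, pval w q ≤ v → v < p → pval w.symm v ≤ q := by
    intro v hv
    induction v, hv using Nat.le_induction with
    | base => exact fun _ => (pval_symm_pval w hq1 (by omega)).le
    | succ v hv ih =>
      intro hvp
      by_contra hlt
      exact hno (v + 1) hvp ((mem_essSet_iff w _ _).2
        ⟨by omega, by omega, hq1, hqn, by omega, by omega, ih (by omega), by omega⟩)
  have hright : ∀ l, q < l → l ≤ n → pval w l < p → pval w l < pval w q := by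
    intro l h1 h2 h3
    by_contra hlt
    have := hleft _ (not_lt.1 hlt) h3
    rw [pval_symm_pval w (by omega) h2] at this
    omega
  simp only [CondW, not_and, not_or, not_not] at hW
  obtain ⟨hD, hW⟩ := hW hno
  obtain ⟨-, -, hq2, -, hwp, -⟩ := (mem_diagram_iff w _ _).1 hD
  have hkq' : k ≠ q := by rintro rfl; omega
  have hkq'' : k ≠ q - 1 := by rintro rfl; omega
  have hsmall : ∀ l, q < l → l ≤ n → pval w l < p → pval w (q - 1) < pval w l := by
    intro l h1 h2 h3
    have h4 := hright l h1 h2 h3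
    by_contra hlt
    have hne : pval w l ≠ pval w (q - 1) := fun h => by
      have h1 := pval_symm_pval w (k := l) (by omega) (by omega)
      have h2 := pval_symm_pval w (k := q - 1) (by omega) (by omega)
      rw [h] at h1
      omega
    exact hcon (containsForbidden_of_ne hE hk1 (c := q - 1) (d := q) (by omega) (by omega)
      (by omega) (by omega) le_rfl h1 h2 (by omega) h4 hwp hwq hk)
  obtain ⟨b, ⟨hqb, hbn, hbp⟩, hmin⟩ := WellFounded.has_min (InvImage.wf (pval w) wellFounded_lt)
    {l | q < l ∧ l ≤ n ∧ pval w l < p} ⟨l, hql, hln, hl⟩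
  have hb := pval_symm_pval w (k := b) (by omega) hbn
  have hsb := hsmall b hqb hbn hbp
  have hbq := hright b hqb hbn hbp
  have hmin' : ∀ l, q ≤ l → l ≤ n → pval w b ≤ pval w l := by
    intro l h1 h2
    rcases h1.eq_or_lt with rfl | h1
    · exact hbq.le
    · by_contra hlt
      exact hmin l ⟨h1, h2, by omega⟩ (not_le.1 hlt)
  have hs1 := pval_pos w (k := q - 1) (by omega) (by omega)
  refine hW ⟨pval w b, hbp, (mem_essSet_iff w _ _).2 ⟨by omega, pval_le _ _, hq2, by omega, hsb,
    ?_, ?_, by omega⟩, ?_, ?_⟩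
  · rw [Nat.sub_add_cancel hq1]
    exact hbq.le
  · by_contra hlt
    have h1 := hmin' (pval w.symm (pval w b - 1)) (by omega) (pval_le _ _)
    rw [pval_pval_symm w (by omega) (by omega)] at h1
    omega
  · rintro ⟨l, h1, h2, h3, h4⟩
    have := hmin' l (by omega) h2
    omega
  · unfold rk
    congr 1
    refine Finset.filter_congr fun j hj => ?_
    rw [Finset.mem_Icc] at hj
    constructor
    · rintro ⟨h1, h2⟩
      refine ⟨by omega, ?_⟩
      by_contra hlt
      have hjs : j ≠ q - 1 := by rintro rfl; omega
      have hjb : pval w j ≠ pval w b := fun h => by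
        have := pval_symm_pval w hj.1 hj.2
        rw [h] at this
        omega
      have hjk : j ≠ k := by rintro rfl; omega
      rcases lt_or_gt_of_ne hjk with h | h
      · exact hcon (containsForbidden_of_lt_of_lt hE hj.1 h (d := q - 1) (by omega) (by omega)
          hqb hbn hsb (by omega) (by omega) hk)
      · exact hcon (containsForbidden_of_ne hE hk1 h (d := q) (by omega) (by omega) (by omega)
          le_rfl hqb hbn (by omega) hbq (by omega) hwq hk)
    · rintro ⟨h1, h2⟩
      have : j ≠ q := by rintro rfl; omega
      exact ⟨by omega, by omega⟩

theorem containsForbidden_or_condW_or_condX (hE : (p, q) ∈ EssSet w) (hA : ¬ CondA w p q)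
    (hB : ¬ CondB w p q) : ContainsForbidden w ∨ CondW w p q ∨ CondX w p q := by
  by_cases h : ∃ p' < p, (p', q) ∈ EssSet w
  · obtain ⟨p', hp, hE'⟩ := h
    exact (containsForbidden_or_condX hE hA hp hE').imp_right .inr
  · push Not at h
    exact (containsForbidden_or_condW hE hA hB h).imp_right .inl

end Forcing

section AntiTranspose

/-- The permutation `w₀ w⁻¹ w₀`, obtained by reflecting the permutation matrix of `w`
in the antidiagonal. -/
def antiTranspose {n : ℕ} (w : Equiv.Perm (Fin n)) : Equiv.Perm (Fin n) :=
  (Fin.revPerm.trans w.symm).trans Fin.revPerm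

variable {n : ℕ} {w : Equiv.Perm (Fin n)} {p q : ℕ}

theorem antiTranspose_symm (w : Equiv.Perm (Fin n)) :
    (antiTranspose w).symm = antiTranspose w.symm :=
  rfl

theorem pval_antiTranspose (w : Equiv.Perm (Fin n)) {k : ℕ} (h1 : 1 ≤ k) (h2 : k ≤ n) :
    pval (antiTranspose w) k = n + 1 - pval w.symm (n + 1 - k) := by
  obtain ⟨i, rfl⟩ : ∃ i : Fin n, k = i + 1 := ⟨⟨k - 1, by omega⟩, by simp; omega⟩
  have hi : n + 1 - (i + 1 : ℕ) = i.rev + 1 := by rw [Fin.val_rev]; omega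
  rw [hi, pval_fin, pval_fin]
  simp only [antiTranspose, Equiv.trans_apply, Fin.revPerm_apply, Fin.val_rev]
  omega

theorem pval_antiTranspose_symm (w : Equiv.Perm (Fin n)) {k : ℕ} (h1 : 1 ≤ k) (h2 : k ≤ n) :
    pval (antiTranspose w).symm k = n + 1 - pval w (n + 1 - k) :=
  pval_antiTranspose w.symm h1 h2

theorem mem_diagram_antiTranspose_iff (hp : p ≤ n + 1) (hq : q ≤ n + 1) :
    (n + 1 - q, n + 1 - p) ∈ Diagram (antiTranspose w) ↔ (p, q) ∈ Diagram w := by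
  rw [mem_diagram_iff, mem_diagram_iff]
  by_cases h : 1 ≤ p ∧ p ≤ n ∧ 1 ≤ q ∧ q ≤ n
  · rw [pval_antiTranspose w (k := n + 1 - p) (by omega) (by omega),
      pval_antiTranspose_symm w (k := n + 1 - q) (by omega) (by omega),
      Nat.sub_sub_self hp, Nat.sub_sub_self hq]
    have := pval_le w q
    have := pval_le w.symm p
    omega
  · omega

theorem mem_essSet_antiTranspose_iff (hp : p ≤ n) (hq : q ≤ n) (hp1 : 1 ≤ p) :
    (n + 1 - q, n + 1 - p) ∈ EssSet (antiTranspose w) ↔ (p, q) ∈ EssSet w := by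
  have h1 := mem_diagram_antiTranspose_iff (w := w) (p := p) (q := q) (by omega) (by omega)
  have h2 := mem_diagram_antiTranspose_iff (w := w) (p := p - 1) (q := q) (by omega) (by omega)
  have h3 := mem_diagram_antiTranspose_iff (w := w) (p := p) (q := q + 1) (by omega) (by omega)
  rw [show n + 1 - (p - 1) = n + 1 - p + 1 by omega] at h2
  rw [show n + 1 - (q + 1) = n + 1 - q - 1 by omega] at h3
  simp only [EssSet, Set.mem_ofPred_eq, h1, h2, h3]
  tauto

theorem CondA.of_antiTranspose (hp : p ≤ n) (hq : q ≤ n)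
    (h : CondA (antiTranspose w) (n + 1 - q) (n + 1 - p)) : CondA w p q := by
  rintro ⟨k, hk1, hkn, hkq, hk⟩
  have := pval_le w k
  have := pval_pos w hk1 hkn
  refine h ⟨n + 1 - pval w k, by omega, by omega, by omega, ?_⟩
  rw [pval_antiTranspose w (by omega) (by omega), Nat.sub_sub_self (by omega),
    pval_symm_pval w hk1 hkn]
  omega

theorem CondB.of_antiTranspose (hp : p ≤ n) (hq : q ≤ n)
    (h : CondB (antiTranspose w) (n + 1 - q) (n + 1 - p)) : CondB w p q := by
  rintro ⟨k, hk1, hkn, hkq, hk⟩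
  have := pval_le w k
  have := pval_pos w hk1 hkn
  refine h ⟨n + 1 - pval w k, by omega, by omega, by omega, ?_⟩
  rw [pval_antiTranspose w (by omega) (by omega), Nat.sub_sub_self (by omega),
    pval_symm_pval w hk1 hkn]
  omega

theorem rk_antiTranspose (hp : p ≤ n + 1) (hp1 : 1 ≤ p) (hq : q ≤ n + 1) :
    rk (antiTranspose w) (n + 1 - q) (n + 1 - p) = rk w p q := by
  unfold rk
  refine Finset.card_nbij' (fun k => n + 1 - pval (antiTranspose w) k)
    (fun k => n + 1 - pval w k) ?_ ?_ ?_ ?_ <;>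
    intro k hk <;>
    simp only [Finset.coe_filter, Finset.mem_Icc, Set.mem_ofPred_eq] at hk ⊢ <;>
    obtain ⟨⟨h1, h2⟩, h3, h4⟩ := hk
  · have h5 := pval_le (antiTranspose w) k
    rw [pval_antiTranspose w h1 h2] at h4 h5 ⊢
    have h6 := pval_pos w.symm (k := n + 1 - k) (by omega) (by omega)
    have h7 := pval_le w.symm (n + 1 - k)
    rw [Nat.sub_sub_self (by omega), pval_pval_symm w (by omega) (by omega)]
    omega
  · have h5 := pval_le w k
    rw [pval_antiTranspose w (by omega) (by omega), Nat.sub_sub_self (by omega),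
      pval_symm_pval w h1 h2]
    omega
  · have h6 := pval_pos w.symm (k := n + 1 - k) (by omega) (by omega)
    have h7 := pval_le w.symm (n + 1 - k)
    rw [pval_antiTranspose w h1 h2, Nat.sub_sub_self (by omega),
      pval_pval_symm w (by omega) (by omega)]
    omega
  · have h5 := pval_le w k
    rw [pval_antiTranspose w (by omega) (by omega),
      Nat.sub_sub_self (show pval w k ≤ n + 1 by omega), pval_symm_pval w h1 h2]
    omega

theorem CondW.of_antiTranspose (hE : (p, q) ∈ EssSet w)
    (h : CondW (antiTranspose w) (n + 1 - q) (n + 1 - p)) : CondY w p q := by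
  obtain ⟨hp2, hpn, hq1, hqn, -⟩ := (mem_essSet_iff w p q).1 hE
  obtain ⟨h1, h2⟩ := h
  refine ⟨fun q' hq' hE' => ?_, h2.imp (mt fun hD' => ?_) ?_⟩
  · obtain ⟨-, -, -, hq'n, -⟩ := (mem_essSet_iff w p q').1 hE'
    exact h1 (n + 1 - q') (by omega)
      ((mem_essSet_antiTranspose_iff hpn hq'n.le (by omega)).2 hE')
  · rw [show n + 1 - p - 1 = n + 1 - (p + 1) by omega]
    exact (mem_diagram_antiTranspose_iff (by omega) (by omega)).2 hD'
  · rintro ⟨s, hs, hEs, hBs, hrs⟩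
    obtain ⟨hs2, hsn, hpp, -⟩ := (mem_essSet_iff _ _ _).1 hEs
    obtain ⟨q', rfl, hq'⟩ : ∃ q', s = n + 1 - q' ∧ q' ≤ n := ⟨n + 1 - s, by omega, by omega⟩
    rw [show n + 1 - p - 1 = n + 1 - (p + 1) by omega] at hEs hBs hrs
    rw [rk_antiTranspose (by omega) (by omega) (by omega),
      rk_antiTranspose (by omega) (by omega) (by omega)] at hrs
    exact ⟨q', by omega, (mem_essSet_antiTranspose_iff (by omega) hq' (by omega)).1 hEs,
      hBs.of_antiTranspose (by omega) hq', hrs⟩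

theorem CondX.of_antiTranspose (hE : (p, q) ∈ EssSet w)
    (h : CondX (antiTranspose w) (n + 1 - q) (n + 1 - p)) : CondZ w p q := by
  obtain ⟨hp2, hpn, hq1, hqn, -⟩ := (mem_essSet_iff w p q).1 hE
  obtain ⟨s, hs, hEs, huniq, hBs, hrs, t, ⟨hmem, hleast⟩, hD⟩ := h
  obtain ⟨hs2, hsn, -⟩ := (mem_essSet_iff _ _ _).1 hEs
  obtain ⟨q', rfl, hq'⟩ : ∃ q', s = n + 1 - q' ∧ q' ≤ n := ⟨n + 1 - s, by omega, by omega⟩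
  rw [rk_antiTranspose (by omega) (by omega) (by omega),
    rk_antiTranspose (by omega) (by omega) (by omega)] at hrs
  refine ⟨q', by omega, (mem_essSet_antiTranspose_iff (by omega) hq' (by omega)).1 hEs, ?_,
    hBs.of_antiTranspose (by omega) hq', hrs, n + 1 - t, ⟨?_, ?_⟩, ?_⟩
  · intro r hr hEr
    obtain ⟨-, -, -, hrn, -⟩ := (mem_essSet_iff w p r).1 hEr
    have := huniq (n + 1 - r) (by omega)
      ((mem_essSet_antiTranspose_iff hpn hrn.le (by omega)).2 hEr)
    omega
  · intro a ha hat
    exact (mem_diagram_antiTranspose_iff (by omega) (by omega)).1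
      (hmem (n + 1 - a) (by omega) (by omega))
  · intro c hc
    have hcn : c ≤ n := by
      by_contra hlt
      have := (mem_diagram_iff w _ _).1 (hc (n + 1) (by omega) (by omega))
      omega
    have : t ≤ n + 1 - c := hleast fun b hb hbp => by
      rw [← Nat.sub_sub_self (show b ≤ n + 1 by omega)]
      exact (mem_diagram_antiTranspose_iff (by omega) (by omega)).2
        (hc (n + 1 - b) (by omega) (by omega))
    omega
  · have := (mem_diagram_iff _ _ _).1 hD
    rw [show t - 1 = n + 1 - (n + 1 - t + 1) by omega] at hD
    exact (mem_diagram_antiTranspose_iff (by omega) (by omega)).1 hD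

theorem ContainsForbidden.of_antiTranspose (h : ContainsForbidden (antiTranspose w)) :
    ContainsForbidden w := by
  -- positions and values of `w` in terms of those of its antitranspose
  have hpos : ∀ k, 1 ≤ k → k ≤ n →
      1 ≤ pval (antiTranspose w) k ∧ pval (antiTranspose w) k ≤ n ∧
      pval w (n + 1 - pval (antiTranspose w) k) = n + 1 - k := by
    intro k h1 h2
    have h7 := pval_le w.symm (n + 1 - k)
    refine ⟨pval_pos _ h1 h2, pval_le _ _, ?_⟩
    rw [pval_antiTranspose w h1 h2, Nat.sub_sub_self (by omega),
      pval_pval_symm w (by omega) (by omega)]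
  rcases h with h | h | h | h | h | h
  · obtain ⟨i₁, i₂, i₃, i₄, i₅, h⟩ := (contains_53241_iff _).1 h
    have h0 := hpos i₁ (by omega) (by omega)
    have h1 := hpos i₂ (by omega) (by omega)
    have h2 := hpos i₃ (by omega) (by omega)
    have h3 := hpos i₄ (by omega) (by omega)
    have h4 := hpos i₅ (by omega) (by omega)
    exact .inr <| .inr <| .inl <| (contains_52431_iff w).2
      ⟨n + 1 - pval (antiTranspose w) i₁, n + 1 - pval (antiTranspose w) i₄,
        n + 1 - pval (antiTranspose w) i₂, n + 1 - pval (antiTranspose w) i₃,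
        n + 1 - pval (antiTranspose w) i₅, by omega⟩
  · obtain ⟨i₁, i₂, i₃, i₄, i₅, h⟩ := (contains_52341_iff _).1 h
    have h0 := hpos i₁ (by omega) (by omega)
    have h1 := hpos i₂ (by omega) (by omega)
    have h2 := hpos i₃ (by omega) (by omega)
    have h3 := hpos i₄ (by omega) (by omega)
    have h4 := hpos i₅ (by omega) (by omega)
    exact .inr <| .inl <| (contains_52341_iff w).2
      ⟨n + 1 - pval (antiTranspose w) i₁, n + 1 - pval (antiTranspose w) i₄,
        n + 1 - pval (antiTranspose w) i₃, n + 1 - pval (antiTranspose w) i₂,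
        n + 1 - pval (antiTranspose w) i₅, by omega⟩
  · obtain ⟨i₁, i₂, i₃, i₄, i₅, h⟩ := (contains_52431_iff _).1 h
    have h0 := hpos i₁ (by omega) (by omega)
    have h1 := hpos i₂ (by omega) (by omega)
    have h2 := hpos i₃ (by omega) (by omega)
    have h3 := hpos i₄ (by omega) (by omega)
    have h4 := hpos i₅ (by omega) (by omega)
    exact .inl <| (contains_53241_iff w).2
      ⟨n + 1 - pval (antiTranspose w) i₁, n + 1 - pval (antiTranspose w) i₃,
        n + 1 - pval (antiTranspose w) i₄, n + 1 - pval (antiTranspose w) i₂,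
        n + 1 - pval (antiTranspose w) i₅, by omega⟩
  · obtain ⟨i₁, i₂, i₃, i₄, i₅, h⟩ := (contains_35142_iff _).1 h
    have h0 := hpos i₁ (by omega) (by omega)
    have h1 := hpos i₂ (by omega) (by omega)
    have h2 := hpos i₃ (by omega) (by omega)
    have h3 := hpos i₄ (by omega) (by omega)
    have h4 := hpos i₅ (by omega) (by omega)
    exact .inr <| .inr <| .inr <| .inr <| .inl <| (contains_42513_iff w).2
      ⟨n + 1 - pval (antiTranspose w) i₂, n + 1 - pval (antiTranspose w) i₄,
        n + 1 - pval (antiTranspose w) i₁, n + 1 - pval (antiTranspose w) i₅,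
        n + 1 - pval (antiTranspose w) i₃, by omega⟩
  · obtain ⟨i₁, i₂, i₃, i₄, i₅, h⟩ := (contains_42513_iff _).1 h
    have h0 := hpos i₁ (by omega) (by omega)
    have h1 := hpos i₂ (by omega) (by omega)
    have h2 := hpos i₃ (by omega) (by omega)
    have h3 := hpos i₄ (by omega) (by omega)
    have h4 := hpos i₅ (by omega) (by omega)
    exact .inr <| .inr <| .inr <| .inl <| (contains_35142_iff w).2
      ⟨n + 1 - pval (antiTranspose w) i₃, n + 1 - pval (antiTranspose w) i₁,
        n + 1 - pval (antiTranspose w) i₅, n + 1 - pval (antiTranspose w) i₂,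
        n + 1 - pval (antiTranspose w) i₄, by omega⟩
  · obtain ⟨i₁, i₂, i₃, i₄, i₅, i₆, h⟩ := (contains_351624_iff _).1 h
    have h0 := hpos i₁ (by omega) (by omega)
    have h1 := hpos i₂ (by omega) (by omega)
    have h2 := hpos i₃ (by omega) (by omega)
    have h3 := hpos i₄ (by omega) (by omega)
    have h4 := hpos i₅ (by omega) (by omega)
    have h5 := hpos i₆ (by omega) (by omega)
    exact .inr <| .inr <| .inr <| .inr <| .inr <| (contains_351624_iff w).2
      ⟨n + 1 - pval (antiTranspose w) i₄, n + 1 - pval (antiTranspose w) i₂,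
        n + 1 - pval (antiTranspose w) i₆, n + 1 - pval (antiTranspose w) i₁,
        n + 1 - pval (antiTranspose w) i₅, n + 1 - pval (antiTranspose w) i₃, by omega⟩

end AntiTranspose

/-- If a permutation is not almost defined by inclusions, then it contains one of the
patterns 53241, 52341, 52431, 35142, 42513, 351624. -/
theorem contains_pattern_of_not_almostDBI {n : ℕ} (w : Equiv.Perm (Fin n))
    (h : ¬ AlmostDBI w) :
    Contains w [5, 3, 2, 4, 1] ∨ Contains w [5, 2, 3, 4, 1] ∨
      Contains w [5, 2, 4, 3, 1] ∨ Contains w [3, 5, 1, 4, 2] ∨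
      Contains w [4, 2, 5, 1, 3] ∨ Contains w [3, 5, 1, 6, 2, 4] := by
  by_contra hcon
  refine h fun p q hE => ?_
  by_contra hpq
  simp only [not_or] at hpq
  obtain ⟨⟨hA, hB⟩, hWY⟩ := hpq
  obtain ⟨hp2, hpn, hq1, hqn, -⟩ := (mem_essSet_iff w p q).1 hE
  refine hWY ⟨(containsForbidden_or_condW_or_condX hE hA hB).resolve_left hcon, ?_⟩
  have hE' := (mem_essSet_antiTranspose_iff hpn hqn.le (by omega)).2 hE
  rcases containsForbidden_or_condW_or_condX hE' (fun h => hA (h.of_antiTranspose hpn hqn.le))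
    (fun h => hB (h.of_antiTranspose hpn hqn.le)) with h | h | h
  · exact (hcon h.of_antiTranspose).elim
  · exact .inl (h.of_antiTranspose hE)
  · exact .inr (h.of_antiTranspose hE)
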